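/- arXiv:2401.00558 — 2 statements merged into one kernel-verified Lean document; each statement's English description precedes it below -/
import Mathlib

section
/- Let 0 < β < 1, γ₁, γ₂ ∈ ℝ and λ₁, λ₂ ∈ ℝ. Then the Horn-function kernels κ(x) = (x^{β−1}/Γ(β)) · Ξ₂(γ₁; γ₂; β; −λ₁x, −λ₂x) and k(x) = (x^{−β}/Γ(1−β)) · Ξ₂(−γ₁; −γ₂; 1−β; −λ₁x, −λ₂x) form a pair of Sonin kernels: for all x > 0, (κ * k)(x) = 1. -/
open MeasureTheory Real

/-- The Pochhammer symbol `(γ)ₙ = γ(γ+1)⋯(γ+n-1)`. -/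
noncomputable def poch (γ : ℝ) (n : ℕ) : ℝ := ∏ i ∈ Finset.range n, (γ + i)

/-- The Horn confluent hypergeometric function
`Ξ₂(γ₁;γ₂;β;y,z) = Σ_{m,n} (γ₁)ₘ(γ₂)ₙ/(β)_{m+n} · yᵐzⁿ/(m!n!)`. -/
noncomputable def hornXi2 (γ₁ γ₂ β y z : ℝ) : ℝ :=
  ∑' q : ℕ × ℕ, poch γ₁ q.1 * poch γ₂ q.2 / poch β (q.1 + q.2) * y ^ q.1 * z ^ q.2 /
    ((q.1.factorial : ℝ) * (q.2.factorial : ℝ))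

open Finset.HasAntidiagonal (antidiagonal mem_antidiagonal)

/-- The Beta integral `∫₀ˣ (x-ξ)^{p-1} ξ^{q-1} dξ`, normalised by Gamma factors. -/
theorem integral_rpow_mul_rpow_div_Gamma {p q x : ℝ} (hp : 0 < p) (hq : 0 < q) (hx : 0 < x) :
    ∫ ξ in (0:ℝ)..x, ((x - ξ) ^ (p - 1) / Real.Gamma p) * (ξ ^ (q - 1) / Real.Gamma q) =
      x ^ (p + q - 1) / Real.Gamma (p + q) := by
  have hbeta : ∫ ξ in (0:ℝ)..x, ξ ^ (q - 1) * (x - ξ) ^ (p - 1) =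
      x ^ (q + p - 1) * (Real.Gamma q * Real.Gamma p / Real.Gamma (q + p)) := by
    have h := Complex.betaIntegral_scaled (q : ℂ) (p : ℂ) hx
    rw [Complex.betaIntegral_eq_Gamma_mul_div _ _ (by simpa) (by simpa)] at h
    have hleft : ∫ ξ in (0:ℝ)..x, (ξ : ℂ) ^ ((q : ℂ) - 1) * ((x : ℂ) - ξ) ^ ((p : ℂ) - 1) =
        ((∫ ξ in (0:ℝ)..x, ξ ^ (q - 1) * (x - ξ) ^ (p - 1) : ℝ) : ℂ) := by
      rw [← intervalIntegral.integral_ofReal]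
      refine intervalIntegral.integral_congr fun ξ hξ => ?_
      rw [Set.uIcc_of_le hx.le] at hξ
      rw [Complex.ofReal_mul, Complex.ofReal_cpow hξ.1, Complex.ofReal_cpow (sub_nonneg.2 hξ.2)]
      push_cast
      rfl
    rw [hleft, ← Complex.ofReal_add, Complex.Gamma_ofReal, Complex.Gamma_ofReal,
      Complex.Gamma_ofReal, ← Complex.ofReal_one, ← Complex.ofReal_sub,
      ← Complex.ofReal_cpow hx.le] at h
    exact_mod_cast h
  have hp' := (Real.Gamma_pos_of_pos hp).ne'
  have hq' := (Real.Gamma_pos_of_pos hq).ne'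
  calc _ = ∫ ξ in (0:ℝ)..x, (1 / (Real.Gamma p * Real.Gamma q)) *
        (ξ ^ (q - 1) * (x - ξ) ^ (p - 1)) := by
        congr 1
        ext ξ
        field_simp
    _ = _ := by
        rw [intervalIntegral.integral_const_mul, hbeta, add_comm q p]
        field_simp

/-- The Beta integral with exponents whose non-integral parts cancel. -/
theorem integral_rpow_add_nat_mul_rpow_add_nat {β x : ℝ} (hβ0 : 0 < β) (hβ1 : β < 1)
    (hx : 0 < x) (m n : ℕ) :
    ∫ ξ in (0:ℝ)..x, ((x - ξ) ^ (β + m - 1) / Real.Gamma (β + m)) *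
        (ξ ^ (1 - β + n - 1) / Real.Gamma (1 - β + n)) =
      x ^ (m + n) / ((m + n).factorial : ℝ) := by
  have hβ' : 0 < 1 - β := sub_pos.2 hβ1
  have hsum : β + (m : ℝ) + (1 - β + (n : ℝ)) = ((m + n : ℕ) : ℝ) + 1 := by
    push_cast
    ring
  rw [integral_rpow_mul_rpow_div_Gamma (by positivity) (by positivity) hx, hsum,
    add_sub_cancel_right, Real.rpow_natCast, Real.Gamma_nat_eq_factorial]

theorem poch_succ (γ : ℝ) (n : ℕ) : poch γ (n + 1) = poch γ n * (γ + n) :=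
  Finset.prod_range_succ _ _

theorem poch_mul_Gamma {β : ℝ} (hβ : 0 < β) (n : ℕ) :
    poch β n * Real.Gamma β = Real.Gamma (β + n) := by
  induction n with
  | zero => simp [poch]
  | succ n ih =>
    rw [poch_succ, Nat.cast_succ, ← add_assoc, Real.Gamma_add_one (by positivity), ← ih]
    ring

theorem abs_poch_div_factorial_le (γ : ℝ) (n : ℕ) :
    |poch γ n / n.factorial| ≤ (1 + |γ|) ^ n := by
  induction n with
  | zero => simp [poch]
  | succ n ih =>
    have hstep : poch γ (n + 1) / (n + 1).factorial =
        poch γ n / n.factorial * ((γ + n) / (n + 1)) := by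
      rw [poch_succ, Nat.factorial_succ]
      push_cast
      field_simp
    have hfactor : |(γ + n) / ((n : ℝ) + 1)| ≤ 1 + |γ| := by
      have hn : (0 : ℝ) ≤ n := n.cast_nonneg
      rw [abs_div, abs_of_pos (by positivity : (0 : ℝ) < n + 1), div_le_iff₀ (by positivity)]
      have h := abs_add_le γ (n : ℝ)
      rw [Nat.abs_cast] at h
      nlinarith [mul_nonneg (abs_nonneg γ) hn]
    rw [hstep, abs_mul, pow_succ]
    gcongr

theorem pow_mul_factorial_le_poch {β : ℝ} (hβ0 : 0 < β) (hβ1 : β ≤ 1) (n : ℕ) :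
    β ^ n * n.factorial ≤ poch β n := by
  induction n with
  | zero => simp [poch]
  | succ n ih =>
    have hn : (0 : ℝ) ≤ n := n.cast_nonneg
    calc β ^ (n + 1) * ((n + 1).factorial : ℝ) = β ^ n * n.factorial * (β * (n + 1)) := by
          rw [Nat.factorial_succ]
          push_cast
          ring
      _ ≤ poch β n * (β + n) := by
          gcongr
          · exact (by positivity : (0 : ℝ) ≤ β ^ n * n.factorial).trans ih
          · nlinarith
      _ = poch β (n + 1) := (poch_succ β n).symm

/-- The coefficients of `(1 - t)^{-γ}` and `(1 - t)^γ` are inverse to each other under Cauchy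
products. -/
theorem sum_antidiagonal_poch_mul_poch_neg (γ : ℝ) (N : ℕ) :
    ∑ p ∈ antidiagonal N,
      (poch γ p.1 / p.1.factorial) * (poch (-γ) p.2 / p.2.factorial) = if N = 0 then 1 else 0 := by
  have hstep : ∀ (δ : ℝ) (n : ℕ), ((n : ℝ) + 1) * (poch δ (n + 1) / (n + 1).factorial) =
      (δ + n) * (poch δ n / n.factorial) := by
    intro δ n
    rw [poch_succ, Nat.factorial_succ]
    push_cast
    field_simp
  set c : ℝ → ℕ → ℝ := fun δ n => poch δ n / n.factorial with hc
  have hrec : ∀ M : ℕ, ((M : ℝ) + 1) * ∑ p ∈ antidiagonal (M + 1), c γ p.1 * c (-γ) p.2 =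
      M * ∑ p ∈ antidiagonal M, c γ p.1 * c (-γ) p.2 := by
    intro M
    have hsplit : ((M : ℝ) + 1) * ∑ p ∈ antidiagonal (M + 1), c γ p.1 * c (-γ) p.2 =
        ∑ p ∈ antidiagonal (M + 1), ((p.1 : ℝ) * c γ p.1) * c (-γ) p.2 +
        ∑ p ∈ antidiagonal (M + 1), c γ p.1 * ((p.2 : ℝ) * c (-γ) p.2) := by
      rw [Finset.mul_sum, ← Finset.sum_add_distrib]
      refine Finset.sum_congr rfl fun p hp => ?_
      have h : (p.1 : ℝ) + p.2 = M + 1 := by exact_mod_cast mem_antidiagonal.1 hp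
      rw [← h]
      ring
    rw [hsplit, Finset.Nat.sum_antidiagonal_succ, Finset.Nat.sum_antidiagonal_succ',
      Finset.mul_sum]
    push_cast
    simp only [hc, hstep, zero_mul, mul_zero, zero_add]
    rw [← Finset.sum_add_distrib]
    refine Finset.sum_congr rfl fun p hp => ?_
    have h : (p.1 : ℝ) + p.2 = M := by exact_mod_cast mem_antidiagonal.1 hp
    rw [← h]
    ring
  have hzero : ∀ M : ℕ, ∑ p ∈ antidiagonal (M + 1), c γ p.1 * c (-γ) p.2 = 0 := by
    intro M
    induction M with
    | zero =>
      have h := hrec 0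
      simpa only [Nat.cast_zero, zero_mul, zero_add, one_mul] using h
    | succ M ih =>
      have h := hrec (M + 1)
      rw [ih, mul_zero] at h
      exact (mul_eq_zero.1 h).resolve_left (by positivity)
  cases N with
  | zero => simp [poch]
  | succ M => simpa using hzero M

/-- The coefficient of `x^{m+n} / (β)_{m+n}` in `Ξ₂(γ₁; γ₂; β; -l₁x, -l₂x)`. -/
noncomputable def hornCoeff (γ₁ γ₂ l₁ l₂ : ℝ) (q : ℕ × ℕ) : ℝ :=
  (poch γ₁ q.1 / q.1.factorial) * (poch γ₂ q.2 / q.2.factorial) * ((-l₁) ^ q.1 * (-l₂) ^ q.2)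

theorem abs_hornCoeff_le (γ₁ γ₂ l₁ l₂ : ℝ) (q : ℕ × ℕ) :
    |hornCoeff γ₁ γ₂ l₁ l₂ q| ≤ ((1 + |γ₁|) * |l₁|) ^ q.1 * ((1 + |γ₂|) * |l₂|) ^ q.2 := by
  rw [hornCoeff, abs_mul, abs_mul, abs_mul, abs_pow, abs_pow, abs_neg, abs_neg, mul_pow, mul_pow,
    mul_mul_mul_comm]
  gcongr <;> exact abs_poch_div_factorial_le _ _

theorem inv_factorial_add_le (m n : ℕ) :
    (1 : ℝ) / (m + n).factorial ≤ 1 / m.factorial * (1 / n.factorial) := by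
  rw [one_div_mul_one_div]
  gcongr
  exact_mod_cast Nat.le_of_dvd (Nat.factorial_pos _)
    (Nat.factorial_mul_factorial_dvd_factorial_add m n)

theorem summable_pow_mul_pow_div_factorial (a b : ℝ) (ha : 0 ≤ a) (hb : 0 ≤ b) :
    Summable fun q : ℕ × ℕ => a ^ q.1 / q.1.factorial * (b ^ q.2 / q.2.factorial) :=
  (Real.summable_pow_div_factorial a).mul_of_nonneg (Real.summable_pow_div_factorial b)
    (fun _ => by positivity) (fun _ => by positivity)

/-- One term of the kernel `t^{β-1}/Γ(β) · Ξ₂(γ₁; γ₂; β; -l₁t, -l₂t)`. -/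
noncomputable def kernelTerm (γ₁ γ₂ β l₁ l₂ : ℝ) (q : ℕ × ℕ) (t : ℝ) : ℝ :=
  hornCoeff γ₁ γ₂ l₁ l₂ q *
    (t ^ (β + (q.1 + q.2 : ℕ) - 1) / Real.Gamma (β + (q.1 + q.2 : ℕ)))

theorem kernelTerm_eq {β t : ℝ} (γ₁ γ₂ l₁ l₂ : ℝ) (hβ : 0 < β) (ht : 0 < t) (q : ℕ × ℕ) :
    kernelTerm γ₁ γ₂ β l₁ l₂ q t = t ^ (β - 1) / Real.Gamma β *
      (hornCoeff γ₁ γ₂ l₁ l₂ q * (t ^ (q.1 + q.2) / poch β (q.1 + q.2))) := by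
  rw [kernelTerm, ← poch_mul_Gamma hβ, add_sub_right_comm, Real.rpow_add_natCast ht.ne']
  ring

theorem tsum_kernelTerm {β t : ℝ} (γ₁ γ₂ l₁ l₂ : ℝ) (hβ : 0 < β) (ht : 0 < t) :
    ∑' q, kernelTerm γ₁ γ₂ β l₁ l₂ q t =
      t ^ (β - 1) / Real.Gamma β * hornXi2 γ₁ γ₂ β (-(l₁ * t)) (-(l₂ * t)) := by
  simp_rw [kernelTerm_eq γ₁ γ₂ l₁ l₂ hβ ht]
  rw [tsum_mul_left, hornXi2]
  congr 2
  ext q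
  rw [hornCoeff, ← neg_mul, ← neg_mul, mul_pow, mul_pow, pow_add]
  ring

theorem summable_norm_kernelTerm {β t : ℝ} (γ₁ γ₂ l₁ l₂ : ℝ) (hβ0 : 0 < β) (hβ1 : β ≤ 1)
    (ht : 0 < t) : Summable fun q => ‖kernelTerm γ₁ γ₂ β l₁ l₂ q t‖ := by
  simp_rw [kernelTerm_eq γ₁ γ₂ l₁ l₂ hβ0 ht, norm_mul _ (hornCoeff _ _ _ _ _ * _)]
  refine Summable.mul_left _ ?_
  set A := (1 + |γ₁|) * |l₁|
  set B := (1 + |γ₂|) * |l₂|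
  have hA : 0 ≤ A := by positivity
  have hB : 0 ≤ B := by positivity
  refine Summable.of_nonneg_of_le (fun _ => norm_nonneg _) (fun q => ?_)
    (summable_pow_mul_pow_div_factorial (A * (t / β)) (B * (t / β)) (by positivity) (by positivity))
  have hpos : 0 < β ^ (q.1 + q.2) * ((q.1 + q.2).factorial : ℝ) := by positivity
  have hpoch := pow_mul_factorial_le_poch hβ0 hβ1 (q.1 + q.2)
  have hquot : 0 ≤ t ^ (q.1 + q.2) / poch β (q.1 + q.2) :=
    div_nonneg (by positivity) (hpos.le.trans hpoch)
  rw [Real.norm_eq_abs, abs_mul, abs_of_nonneg hquot]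
  calc |hornCoeff γ₁ γ₂ l₁ l₂ q| * (t ^ (q.1 + q.2) / poch β (q.1 + q.2))
      ≤ (A ^ q.1 * B ^ q.2) *
          (t ^ (q.1 + q.2) / (β ^ (q.1 + q.2) * ((q.1 + q.2).factorial : ℝ))) := by
        gcongr
        exact abs_hornCoeff_le _ _ _ _ _
    _ = (A * (t / β)) ^ q.1 * (B * (t / β)) ^ q.2 * (1 / ((q.1 + q.2).factorial : ℝ)) := by
        rw [mul_pow A, mul_pow B, ← div_div, ← div_pow, pow_add]
        ring
    _ ≤ (A * (t / β)) ^ q.1 * (B * (t / β)) ^ q.2 *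
          (1 / (q.1.factorial : ℝ) * (1 / (q.2.factorial : ℝ))) := by
        gcongr
        exact inv_factorial_add_le _ _
    _ = _ := by ring

theorem integral_kernelTerm_mul {γ₁ γ₂ δ₁ δ₂ l₁ l₂ β x : ℝ} (hβ0 : 0 < β) (hβ1 : β < 1)
    (hx : 0 < x) (q r : ℕ × ℕ) :
    ∫ ξ in (0:ℝ)..x, kernelTerm γ₁ γ₂ β l₁ l₂ q (x - ξ) * kernelTerm δ₁ δ₂ (1 - β) l₁ l₂ r ξ =
      hornCoeff γ₁ γ₂ l₁ l₂ q * hornCoeff δ₁ δ₂ l₁ l₂ r *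
        (x ^ (q.1 + q.2 + (r.1 + r.2)) / ((q.1 + q.2 + (r.1 + r.2)).factorial : ℝ)) := by
  simp_rw [kernelTerm, mul_mul_mul_comm (hornCoeff _ _ _ _ _)]
  rw [intervalIntegral.integral_const_mul,
    integral_rpow_add_nat_mul_rpow_add_nat hβ0 hβ1 hx]

theorem intervalIntegrable_kernelTerm_mul {γ₁ γ₂ δ₁ δ₂ l₁ l₂ β x : ℝ} (hβ0 : 0 < β)
    (hβ1 : β < 1) (hx : 0 < x) (q r : ℕ × ℕ) :
    IntervalIntegrable
      (fun ξ => kernelTerm γ₁ γ₂ β l₁ l₂ q (x - ξ) * kernelTerm δ₁ δ₂ (1 - β) l₁ l₂ r ξ)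
      volume 0 x := by
  simp_rw [kernelTerm, mul_mul_mul_comm (hornCoeff _ _ _ _ _)]
  refine IntervalIntegrable.const_mul ?_ _
  apply intervalIntegral.intervalIntegrable_of_integral_ne_zero
  rw [integral_rpow_add_nat_mul_rpow_add_nat hβ0 hβ1 hx]
  positivity

theorem integral_norm_kernelTerm_mul {γ₁ γ₂ δ₁ δ₂ l₁ l₂ β x : ℝ} (hβ0 : 0 < β) (hβ1 : β < 1)
    (hx : 0 < x) (q r : ℕ × ℕ) :
    ∫ ξ in (0:ℝ)..x, ‖kernelTerm γ₁ γ₂ β l₁ l₂ q (x - ξ) * kernelTerm δ₁ δ₂ (1 - β) l₁ l₂ r ξ‖ =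
      |hornCoeff γ₁ γ₂ l₁ l₂ q| * |hornCoeff δ₁ δ₂ l₁ l₂ r| *
        (x ^ (q.1 + q.2 + (r.1 + r.2)) / ((q.1 + q.2 + (r.1 + r.2)).factorial : ℝ)) := by
  have hβ' : 0 < 1 - β := sub_pos.2 hβ1
  have hnorm : Set.EqOn
      (fun ξ => ‖kernelTerm γ₁ γ₂ β l₁ l₂ q (x - ξ) * kernelTerm δ₁ δ₂ (1 - β) l₁ l₂ r ξ‖)
      (fun ξ => |hornCoeff γ₁ γ₂ l₁ l₂ q| * |hornCoeff δ₁ δ₂ l₁ l₂ r| *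
        (((x - ξ) ^ (β + (q.1 + q.2 : ℕ) - 1) / Real.Gamma (β + (q.1 + q.2 : ℕ))) *
          (ξ ^ (1 - β + (r.1 + r.2 : ℕ) - 1) / Real.Gamma (1 - β + (r.1 + r.2 : ℕ)))))
      (Set.uIcc 0 x) := by
    intro ξ hξ
    rw [Set.uIcc_of_le hx.le] at hξ
    have h₁ : 0 ≤ (x - ξ) ^ (β + (q.1 + q.2 : ℕ) - 1) / Real.Gamma (β + (q.1 + q.2 : ℕ)) :=
      div_nonneg (Real.rpow_nonneg (sub_nonneg.2 hξ.2) _)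
        (Real.Gamma_pos_of_pos (by positivity)).le
    have h₂ : 0 ≤ ξ ^ (1 - β + (r.1 + r.2 : ℕ) - 1) / Real.Gamma (1 - β + (r.1 + r.2 : ℕ)) :=
      div_nonneg (Real.rpow_nonneg hξ.1 _) (Real.Gamma_pos_of_pos (by positivity)).le
    simp only [kernelTerm]
    rw [mul_mul_mul_comm, Real.norm_eq_abs, abs_mul, abs_mul, abs_of_nonneg (mul_nonneg h₁ h₂)]
  rw [intervalIntegral.integral_congr hnorm, intervalIntegral.integral_const_mul,
    integral_rpow_add_nat_mul_rpow_add_nat hβ0 hβ1 hx]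

theorem summable_abs_hornCoeff_mul (γ₁ γ₂ δ₁ δ₂ l₁ l₂ : ℝ) {x : ℝ} (hx : 0 < x) :
    Summable fun s : (ℕ × ℕ) × (ℕ × ℕ) =>
      |hornCoeff γ₁ γ₂ l₁ l₂ s.1| * |hornCoeff δ₁ δ₂ l₁ l₂ s.2| *
        (x ^ (s.1.1 + s.1.2 + (s.2.1 + s.2.2)) /
          ((s.1.1 + s.1.2 + (s.2.1 + s.2.2)).factorial : ℝ)) := by
  set A := (1 + |γ₁|) * |l₁|
  set B := (1 + |γ₂|) * |l₂|
  set C := (1 + |δ₁|) * |l₁|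
  set D := (1 + |δ₂|) * |l₂|
  have hA : 0 ≤ A := by positivity
  have hB : 0 ≤ B := by positivity
  have hC : 0 ≤ C := by positivity
  have hD : 0 ≤ D := by positivity
  refine Summable.of_nonneg_of_le (fun _ => by positivity) (fun s => ?_)
    ((summable_pow_mul_pow_div_factorial (A * x) (B * x) (by positivity)
      (by positivity)).mul_of_nonneg
      (summable_pow_mul_pow_div_factorial (C * x) (D * x) (by positivity) (by positivity))
      (fun _ => by positivity) (fun _ => by positivity))
  obtain ⟨⟨a, b⟩, ⟨c, d⟩⟩ := s
  have hfac : (1 : ℝ) / (a + b + (c + d)).factorial ≤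
      1 / a.factorial * (1 / b.factorial) * (1 / c.factorial * (1 / d.factorial)) :=
    (inv_factorial_add_le _ _).trans <| by
      gcongr <;> exact inv_factorial_add_le _ _
  calc |hornCoeff γ₁ γ₂ l₁ l₂ (a, b)| * |hornCoeff δ₁ δ₂ l₁ l₂ (c, d)| *
        (x ^ (a + b + (c + d)) / ((a + b + (c + d)).factorial : ℝ))
      ≤ (A ^ a * B ^ b) * (C ^ c * D ^ d) *
        (x ^ (a + b + (c + d)) / ((a + b + (c + d)).factorial : ℝ)) := by
        gcongr
        · exact abs_hornCoeff_le _ _ _ _ _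
        · exact abs_hornCoeff_le _ _ _ _ _
    _ = (A * x) ^ a * (B * x) ^ b * ((C * x) ^ c * (D * x) ^ d) *
          (1 / ((a + b + (c + d)).factorial : ℝ)) := by
        rw [pow_add, pow_add, pow_add, mul_pow A, mul_pow B, mul_pow C, mul_pow D]
        ring
    _ ≤ (A * x) ^ a * (B * x) ^ b * ((C * x) ^ c * (D * x) ^ d) *
          (1 / a.factorial * (1 / b.factorial) * (1 / c.factorial * (1 / d.factorial))) := by
        gcongr
    _ = _ := by
        simp only
        ring

theorem tsum_hornCoeff_mul_hornCoeff_neg (γ₁ γ₂ l₁ l₂ : ℝ) {x : ℝ} (hx : 0 < x) :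
    ∑' s : (ℕ × ℕ) × (ℕ × ℕ), hornCoeff γ₁ γ₂ l₁ l₂ s.1 * hornCoeff (-γ₁) (-γ₂) l₁ l₂ s.2 *
        (x ^ (s.1.1 + s.1.2 + (s.2.1 + s.2.2)) /
          ((s.1.1 + s.1.2 + (s.2.1 + s.2.2)).factorial : ℝ)) = 1 := by
  have hsumm : Summable fun s : (ℕ × ℕ) × (ℕ × ℕ) =>
      hornCoeff γ₁ γ₂ l₁ l₂ s.1 * hornCoeff (-γ₁) (-γ₂) l₁ l₂ s.2 *
        (x ^ (s.1.1 + s.1.2 + (s.2.1 + s.2.2)) /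
          ((s.1.1 + s.1.2 + (s.2.1 + s.2.2)).factorial : ℝ)) := by
    refine Summable.of_norm_bounded (summable_abs_hornCoeff_mul γ₁ γ₂ (-γ₁) (-γ₂) l₁ l₂ hx)
      fun s => ?_
    rw [Real.norm_eq_abs, abs_mul, abs_mul,
      abs_of_nonneg (by positivity : 0 ≤ x ^ (s.1.1 + s.1.2 + (s.2.1 + s.2.2)) /
          ((s.1.1 + s.1.2 + (s.2.1 + s.2.2)).factorial : ℝ))]
  have hre := ((Equiv.prodProdProdComm ℕ ℕ ℕ ℕ).hasSum_iff.2 hsumm.hasSum).tsum_fiberwise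
    fun s : (ℕ × ℕ) × (ℕ × ℕ) => (s.1.1 + s.1.2, s.2.1 + s.2.2)
  refine hre.unique ?_
  have hfiber : ∀ M N : ℕ,
      (fun s : (ℕ × ℕ) × (ℕ × ℕ) => (s.1.1 + s.1.2, s.2.1 + s.2.2)) ⁻¹' {(M, N)} =
        (↑(antidiagonal M ×ˢ antidiagonal N) : Set ((ℕ × ℕ) × (ℕ × ℕ))) := by
    intro M N
    ext s
    simp
  refine (hasSum_ite_eq ((0, 0) : ℕ × ℕ) (1 : ℝ)).congr_fun ?_
  rintro ⟨M, N⟩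
  rw [hfiber, Finset.tsum_subtype' (antidiagonal M ×ˢ antidiagonal N)
    (_ ∘ (Equiv.prodProdProdComm ℕ ℕ ℕ ℕ))]
  calc _ = ∑ s ∈ antidiagonal M ×ˢ antidiagonal N,
        ((poch γ₁ s.1.1 / s.1.1.factorial) * (poch (-γ₁) s.1.2 / s.1.2.factorial)) *
        ((poch γ₂ s.2.1 / s.2.1.factorial) * (poch (-γ₂) s.2.2 / s.2.2.factorial)) *
        ((-l₁) ^ M * (-l₂) ^ N * (x ^ (M + N) / ((M + N).factorial : ℝ))) := by
        refine Finset.sum_congr rfl fun s hs => ?_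
        obtain ⟨⟨a, b⟩, ⟨c, d⟩⟩ := s
        simp only [Finset.mem_product, mem_antidiagonal] at hs
        obtain ⟨rfl, rfl⟩ := hs
        simp only [Function.comp, Equiv.prodProdProdComm_apply, hornCoeff]
        rw [add_add_add_comm a c b d, pow_add (-l₁), pow_add (-l₂)]
        ring
    _ = _ := by
        rw [← Finset.sum_mul, Finset.sum_product]
        simp only
        rw [← Finset.sum_mul_sum, sum_antidiagonal_poch_mul_poch_neg,
          sum_antidiagonal_poch_mul_poch_neg]
        by_cases hM : M = 0 <;> by_cases hN : N = 0 <;> simp [hM, hN]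

/-- The Horn-function kernels `(x^{β-1}/Γ(β))·Ξ₂(γ₁;γ₂;β;-λ₁x,-λ₂x)` and
`(x^{-β}/Γ(1-β))·Ξ₂(-γ₁;-γ₂;1-β;-λ₁x,-λ₂x)` form a pair of Sonin kernels. -/
theorem hornXi2_kernels_sonin (β γ₁ γ₂ lam₁ lam₂ : ℝ) (hβ0 : 0 < β) (hβ1 : β < 1)
    (x : ℝ) (hx : 0 < x) :
    ∫ ξ in (0:ℝ)..x,
      ((x - ξ) ^ (β - 1) / Real.Gamma β *
        hornXi2 γ₁ γ₂ β (-(lam₁ * (x - ξ))) (-(lam₂ * (x - ξ)))) *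
      (ξ ^ (-β) / Real.Gamma (1 - β) *
        hornXi2 (-γ₁) (-γ₂) (1 - β) (-(lam₁ * ξ)) (-(lam₂ * ξ))) = 1 := by
  have hβ' : 0 < 1 - β := sub_pos.2 hβ1
  set F : (ℕ × ℕ) × (ℕ × ℕ) → ℝ → ℝ := fun s ξ =>
    kernelTerm γ₁ γ₂ β lam₁ lam₂ s.1 (x - ξ) * kernelTerm (-γ₁) (-γ₂) (1 - β) lam₁ lam₂ s.2 ξ
    with hF
  have hset : ∀ f : ℝ → ℝ, ∫ ξ in Set.Ioo 0 x, f ξ = ∫ ξ in (0:ℝ)..x, f ξ := fun f => by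
    rw [intervalIntegral.integral_of_le hx.le, integral_Ioc_eq_integral_Ioo]
  have hint : ∀ s, IntegrableOn (F s) (Set.Ioo 0 x) := fun s =>
    ((intervalIntegrable_iff_integrableOn_Ioo_of_le hx.le).1
      (intervalIntegrable_kernelTerm_mul hβ0 hβ1 hx s.1 s.2))
  have hnorm : Summable fun s => ∫ ξ in Set.Ioo 0 x, ‖F s ξ‖ := by
    simp_rw [hset, hF, integral_norm_kernelTerm_mul hβ0 hβ1 hx]
    exact summable_abs_hornCoeff_mul _ _ _ _ _ _ hx
  rw [← hset]
  calc _ = ∫ ξ in Set.Ioo 0 x, ∑' s, F s ξ := by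
        refine setIntegral_congr_fun measurableSet_Ioo fun ξ hξ => ?_
        have hξ' : 0 < x - ξ := sub_pos.2 hξ.2
        have hk := tsum_kernelTerm (-γ₁) (-γ₂) lam₁ lam₂ hβ' hξ.1
        rw [show 1 - β - 1 = -β by ring] at hk
        rw [← hk, ← tsum_kernelTerm γ₁ γ₂ lam₁ lam₂ hβ0 hξ']
        exact tsum_mul_tsum_of_summable_norm
          (summable_norm_kernelTerm γ₁ γ₂ lam₁ lam₂ hβ0 hβ1.le hξ')
          (summable_norm_kernelTerm (-γ₁) (-γ₂) lam₁ lam₂ hβ' (by linarith) hξ.1)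
    _ = ∑' s, ∫ ξ in Set.Ioo 0 x, F s ξ :=
        (integral_tsum_of_summable_integral_norm hint hnorm).symm
    _ = 1 := by
        simp_rw [hset, hF, integral_kernelTerm_mul hβ0 hβ1 hx]
        exact tsum_hornCoeff_mul_hornCoeff_neg γ₁ γ₂ lam₁ lam₂ hx
end

section
/- Let α₁ > 0, α₂ > 0, β > 0, γ₁, γ₂ ∈ ℝ, λ₁, λ₂ ∈ ℝ and p > 0 with |λ₁| p^{−α₁} < 1 and |λ₂| p^{−α₂} < 1. Then the Laplace transform of the kernel x^{β−1} ξ₂(γ₁; γ₂; (α₁,α₂;β); −λ₁ x^{α₁}, −λ₂ x^{α₂}) equals p^{α₁γ₁+α₂γ₂−β} (p^{α₁}+λ₁)^{−γ₁} (p^{α₂}+λ₂)^{−γ₂}: ∫₀^∞ e^{−px} x^{β−1} ξ₂(γ₁; γ₂; (α₁,α₂;β); −λ₁ x^{α₁}, −λ₂ x^{α₂}) dx = p^{α₁γ₁+α₂γ₂−β} (p^{α₁}+λ₁)^{−γ₁} (p^{α₂}+λ₂)^{−γ₂}. -/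
open MeasureTheory Real

/-- The generalized Horn-type function
`ξ₂(γ₁;γ₂;(α₁,α₂;β);y,z) = Σ_{m,n} (γ₁)ₘ(γ₂)ₙ/Γ(α₁m+α₂n+β) · yᵐzⁿ/(m!n!)`. -/
noncomputable def xi2 (γ₁ γ₂ α₁ α₂ β y z : ℝ) : ℝ :=
  ∑' q : ℕ × ℕ, poch γ₁ q.1 * poch γ₂ q.2 / Real.Gamma (α₁ * q.1 + α₂ * q.2 + β) *
    y ^ q.1 * z ^ q.2 / ((q.1.factorial : ℝ) * (q.2.factorial : ℝ))

lemma choose_add_sub_one_eq_poch_div_factorial (γ : ℝ) (n : ℕ) :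
    Ring.choose (γ + n - 1) n = poch γ n / n.factorial := by
  have heval : poch γ n = (ascPochhammer ℝ n).eval γ := by
    induction n with
    | zero => simp [poch]
    | succ k ih =>
      rw [ascPochhammer_succ_eval, ← ih, poch, poch, Finset.prod_range_succ]
  have h := Ring.factorial_nsmul_multichoose_eq_ascPochhammer γ n
  rw [Polynomial.ascPochhammer_smeval_eq_eval, ← heval, nsmul_eq_mul] at h
  rw [Ring.choose, show γ + n - 1 - n + 1 = γ by ring, ← h,
    mul_div_cancel_left₀ _ (by positivity)]

lemma hasFPowerSeriesOnBall_one_div_one_sub_rpow (γ : ℝ) :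
    HasFPowerSeriesOnBall (fun x : ℝ ↦ 1 / (1 - x) ^ γ)
      (.ofScalars ℝ fun n ↦ poch γ n / n.factorial) 0 1 := by
  simpa only [choose_add_sub_one_eq_poch_div_factorial] using
    Real.one_div_one_sub_rpow_hasFPowerSeriesOnBall_zero γ

lemma summable_norm_poch_mul_pow (γ : ℝ) {x : ℝ} (hx : |x| < 1) :
    Summable fun n : ℕ ↦ ‖poch γ n / n.factorial * x ^ n‖ := by
  have h := hasFPowerSeriesOnBall_one_div_one_sub_rpow γ
  have hx1 : x ∈ Metric.eball (0 : ℝ) 1 := by simpa [enorm_eq_nnnorm] using! hx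
  have hs := FormalMultilinearSeries.summable_norm_apply _ (Metric.eball_subset_eball h.r_le hx1)
  simpa only [FormalMultilinearSeries.ofScalars_apply_eq, smul_eq_mul] using hs

lemma hasSum_poch_mul_pow (γ : ℝ) {x : ℝ} (hx : |x| < 1) :
    HasSum (fun n : ℕ ↦ poch γ n / n.factorial * x ^ n) ((1 - x) ^ (-γ)) := by
  have hx1 : x ∈ Metric.eball (0 : ℝ) 1 := by simpa [enorm_eq_nnnorm] using! hx
  have hs := (hasFPowerSeriesOnBall_one_div_one_sub_rpow γ).hasSum hx1
  rw [Real.rpow_neg (by linarith [le_abs_self x]), ← one_div]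
  simpa only [FormalMultilinearSeries.ofScalars_apply_eq, smul_eq_mul, zero_add] using hs

lemma integrableOn_exp_neg_mul_mul_rpow {s p : ℝ} (hs : 0 < s) (hp : 0 < p) :
    IntegrableOn (fun x : ℝ ↦ exp (-(p * x)) * x ^ (s - 1)) (Set.Ioi 0) := by
  have h := integrableOn_rpow_mul_exp_neg_mul_rpow (p := 1) (s := s - 1) (by linarith) one_pos hp
  simpa only [rpow_one, neg_mul, mul_comm (rexp _)] using h

lemma integral_exp_neg_mul_mul_rpow {s p : ℝ} (hs : 0 < s) (hp : 0 < p) :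
    ∫ x in Set.Ioi (0 : ℝ), exp (-(p * x)) * x ^ (s - 1) = Gamma s * p ^ (-s) := by
  simp_rw [mul_comm (rexp _)]
  rw [integral_rpow_mul_exp_neg_mul_Ioi hs hp, one_div, inv_rpow hp.le, rpow_neg hp.le, mul_comm]

/-- Termwise Laplace transform of a generalized power series, normalized so that the transform at
`p` is the sum of its coefficients. -/
lemma hasSum_integral_exp_neg_mul_tsum {ι : Type*} [Countable ι] {a s : ι → ℝ} {p : ℝ}
    (ha : Summable fun q ↦ ‖a q‖) (hs : ∀ q, 0 < s q) (hp : 0 < p) :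
    HasSum a (∫ x in Set.Ioi (0 : ℝ),
      ∑' q, a q * p ^ s q / Gamma (s q) * (exp (-(p * x)) * x ^ (s q - 1))) := by
  have hint (c : ℝ) (q : ι) : ∫ x in Set.Ioi (0 : ℝ),
      c * p ^ s q / Gamma (s q) * (exp (-(p * x)) * x ^ (s q - 1)) = c := by
    have hG := (Gamma_pos_of_pos (hs q)).ne'
    have hP := (rpow_pos_of_pos hp (s q)).ne'
    rw [integral_const_mul, integral_exp_neg_mul_mul_rpow (hs q) hp, rpow_neg hp.le]
    field_simp
  have hnorm (q : ι) : ∫ x in Set.Ioi (0 : ℝ),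
      ‖a q * p ^ s q / Gamma (s q) * (exp (-(p * x)) * x ^ (s q - 1))‖ = ‖a q‖ := by
    rw [← hint ‖a q‖ q]
    refine setIntegral_congr_fun measurableSet_Ioi fun x hx ↦ ?_
    simp only [norm_mul, norm_div, norm_of_nonneg (rpow_nonneg (le_of_lt hx) _),
      norm_of_nonneg (Gamma_pos_of_pos (hs q)).le, norm_of_nonneg (rpow_nonneg hp.le _),
      norm_of_nonneg (exp_pos _).le]
  have h := hasSum_integral_of_summable_integral_norm
    (fun q ↦ (integrableOn_exp_neg_mul_mul_rpow (hs q) hp).const_mul (a q * p ^ s q / Gamma (s q)))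
    (by simpa only [hnorm] using ha)
  simpa only [hint] using h

/-- Rescaling of a binomial factor from `1 + l p^{-α}` to `p^α + l`. -/
lemma one_sub_neg_mul_rpow_neg {p α l : ℝ} (γ : ℝ) (hp : 0 < p) (hl : |l| * p ^ (-α) < 1) :
    (1 - -(l * p ^ (-α))) ^ (-γ) = p ^ (α * γ) * (p ^ α + l) ^ (-γ) := by
  have hpα : 0 < p ^ α := rpow_pos_of_pos hp α
  have hlt : |l| < p ^ α := by
    rwa [rpow_neg hp.le, ← div_eq_mul_inv, div_lt_one hpα] at hl
  have hpos : 0 < p ^ α + l := by linarith [neg_abs_le l]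
  have hfac : 1 - -(l * p ^ (-α)) = p ^ (-α) * (p ^ α + l) := by
    rw [rpow_neg hp.le]; field_simp; ring
  rw [hfac, mul_rpow (rpow_nonneg hp.le _) hpos.le, ← rpow_mul hp.le, neg_mul_neg]

/-- The Laplace transform of the kernel `x^{β-1}ξ₂(γ₁;γ₂;(α₁,α₂;β);-λ₁x^{α₁},-λ₂x^{α₂})` is
`p^{α₁γ₁+α₂γ₂-β}·(p^{α₁}+λ₁)^{-γ₁}·(p^{α₂}+λ₂)^{-γ₂}`. -/
theorem laplace_xi2_kernel (α₁ α₂ β γ₁ γ₂ lam₁ lam₂ p : ℝ)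
    (hα₁ : 0 < α₁) (hα₂ : 0 < α₂) (hβ : 0 < β) (hp : 0 < p)
    (hlam₁ : |lam₁| * p ^ (-α₁) < 1) (hlam₂ : |lam₂| * p ^ (-α₂) < 1) :
    ∫ x in Set.Ioi (0:ℝ), Real.exp (-(p * x)) *
        (x ^ (β - 1) * xi2 γ₁ γ₂ α₁ α₂ β (-(lam₁ * x ^ α₁)) (-(lam₂ * x ^ α₂)))
      = p ^ (α₁ * γ₁ + α₂ * γ₂ - β) * (p ^ α₁ + lam₁) ^ (-γ₁) * (p ^ α₂ + lam₂) ^ (-γ₂) := by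
  obtain ⟨x₁, hx₁_def⟩ : ∃ x, x = -(lam₁ * p ^ (-α₁)) := ⟨_, rfl⟩
  obtain ⟨x₂, hx₂_def⟩ : ∃ x, x = -(lam₂ * p ^ (-α₂)) := ⟨_, rfl⟩
  have hx₁ : |x₁| < 1 := by
    rwa [hx₁_def, abs_neg, abs_mul, abs_of_pos (rpow_pos_of_pos hp _)]
  have hx₂ : |x₂| < 1 := by
    rwa [hx₂_def, abs_neg, abs_mul, abs_of_pos (rpow_pos_of_pos hp _)]
  have hs (q : ℕ × ℕ) : 0 < α₁ * q.1 + α₂ * q.2 + β := by positivity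
  have hsum_norm := (summable_norm_poch_mul_pow γ₁ hx₁).mul_norm (summable_norm_poch_mul_pow γ₂ hx₂)
  have hsum := (hasSum_poch_mul_pow γ₁ hx₁).mul (hasSum_poch_mul_pow γ₂ hx₂) hsum_norm.of_norm
  have hint := hasSum_integral_exp_neg_mul_tsum hsum_norm hs hp
  have hterm : ∀ x ∈ Set.Ioi (0 : ℝ), exp (-(p * x)) *
      (x ^ (β - 1) * xi2 γ₁ γ₂ α₁ α₂ β (-(lam₁ * x ^ α₁)) (-(lam₂ * x ^ α₂))) =
      p ^ (-β) * ∑' q : ℕ × ℕ,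
        poch γ₁ q.1 / q.1.factorial * x₁ ^ q.1 * (poch γ₂ q.2 / q.2.factorial * x₂ ^ q.2) *
          p ^ (α₁ * q.1 + α₂ * q.2 + β) / Gamma (α₁ * q.1 + α₂ * q.2 + β) *
          (exp (-(p * x)) * x ^ (α₁ * q.1 + α₂ * q.2 + β - 1)) := by
    intro x hx
    have hx0 : 0 < x := hx
    simp only [xi2, ← tsum_mul_left]
    congr 1 with q
    have hxs : x ^ (α₁ * q.1 + α₂ * q.2 + β - 1) =
        x ^ (β - 1) * (x ^ α₁) ^ q.1 * (x ^ α₂) ^ q.2 := by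
      rw [← rpow_natCast, ← rpow_natCast, ← rpow_mul hx0.le, ← rpow_mul hx0.le,
        ← rpow_add hx0, ← rpow_add hx0]
      congr 1; ring
    have hps : p ^ (α₁ * q.1 + α₂ * q.2 + β) =
        (p ^ α₁) ^ q.1 * (p ^ α₂) ^ q.2 * p ^ β := by
      rw [← rpow_natCast, ← rpow_natCast, ← rpow_mul hp.le, ← rpow_mul hp.le,
        ← rpow_add hp, ← rpow_add hp]
    have hG := (Gamma_pos_of_pos (hs q)).ne'
    have h1 := (rpow_pos_of_pos hp α₁).ne'
    have h2 := (rpow_pos_of_pos hp α₂).ne'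
    have h3 := (rpow_pos_of_pos hp β).ne'
    simp only [hxs, hps, hx₁_def, hx₂_def, rpow_neg hp.le, neg_pow (lam₁ * _), neg_pow (lam₂ * _),
      mul_pow, inv_pow]
    field_simp
  rw [setIntegral_congr_fun measurableSet_Ioi hterm, integral_const_mul, hint.unique hsum,
    hx₁_def, hx₂_def, one_sub_neg_mul_rpow_neg γ₁ hp hlam₁, one_sub_neg_mul_rpow_neg γ₂ hp hlam₂,
    show α₁ * γ₁ + α₂ * γ₂ - β = -β + α₁ * γ₁ + α₂ * γ₂ by ring, rpow_add hp, rpow_add hp]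
  ring
end
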